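/- Let n ≥ 2 and let Ω ⊂ ℝⁿ be a bounded open convex set with C¹ boundary, with outward unit normal ν. Then for every point x in the frontier of Ω, ∫_{∂Ω} |⟨ν(x), y − x⟩ · ⟨y − x, ν(y)⟩| / ‖x − y‖^{n+1} dσ(y) = c_n, where c_n = (1/2) ∫_{S^{n−1}} |w₁| dσ(w). -/

import Mathlib

open MeasureTheory RealInnerProductSpace

section KernelIntegral

open Set Filter Topology Module
open scoped NNReal ENNReal

theorem hausdorffMeasure_image_le_of_edist_le {X Y Z : Type*}
    [EMetricSpace Y] [MeasurableSpace Y] [BorelSpace Y]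
    [EMetricSpace Z] [MeasurableSpace Z] [BorelSpace Z]
    {f : X → Y} {g : X → Z} {s : Set X} {K : ℝ≥0} {d : ℝ} (hd : 0 ≤ d)
    (h : ∀ u ∈ s, ∀ v ∈ s, edist (f u) (f v) ≤ K * edist (g u) (g v)) :
    μH[d] (f '' s) ≤ (K : ℝ≥0∞) ^ d * μH[d] (g '' s) := by
  rcases s.eq_empty_or_nonempty with rfl | ⟨a, -⟩
  · simp
  have : Nonempty X := ⟨a⟩
  have hinv : ∀ u ∈ s, Function.invFunOn g s (g u) ∈ s ∧ g (Function.invFunOn g s (g u)) = g u :=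
    fun u hu => Function.invFunOn_pos ⟨u, hu, rfl⟩
  have hL : LipschitzOnWith K (f ∘ Function.invFunOn g s) (g '' s) := by
    rintro _ ⟨u, hu, rfl⟩ _ ⟨v, hv, rfl⟩
    refine (h _ (hinv u hu).1 _ (hinv v hv).1).trans ?_
    rw [(hinv u hu).2, (hinv v hv).2]
  refine le_trans (measure_mono ?_) (hL.hausdorffMeasure_image_le hd)
  rintro _ ⟨u, hu, rfl⟩
  refine ⟨g u, ⟨u, hu, rfl⟩, ?_⟩
  have := h _ (hinv u hu).1 _ hu
  rw [(hinv u hu).2, edist_self, mul_zero] at this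
  exact edist_le_zero.1 this

theorem MeasureTheory.Measure.le_of_locally_le {X : Type*} [TopologicalSpace X]
    [SecondCountableTopology X] [MeasurableSpace X] [OpensMeasurableSpace X] {μ ν : Measure X}
    (h : ∀ x, ∃ U ∈ 𝓝 x, ∀ s ⊆ U, MeasurableSet s → μ s ≤ ν s) : μ ≤ ν := by
  choose U hU hle using h
  obtain ⟨T, hT, hcov⟩ := TopologicalSpace.countable_cover_nhds
    (fun x => interior_mem_nhds.2 (hU x))
  rcases T.eq_empty_or_nonempty with rfl | hne
  · refine Measure.le_iff.2 fun s _ => ?_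
    have : s = ∅ := by
      rw [eq_empty_iff_forall_notMem]
      intro x
      have : x ∈ (univ : Set X) := mem_univ x
      simp [← hcov] at this
    simp [this]
  obtain ⟨e, rfl⟩ := hT.exists_eq_range hne
  rw [biUnion_range] at hcov
  set D := disjointed fun n => interior (U (e n))
  have hD : ∀ n, MeasurableSet (D n) :=
    MeasurableSet.disjointed fun n => isOpen_interior.measurableSet
  have hDU : ⋃ n, D n = univ := by rw [iUnion_disjointed, hcov]
  have key : ∀ (m : Measure X) s, MeasurableSet s → m s = ∑' n, m (s ∩ D n) := by
    intro m s hs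
    rw [← measure_iUnion, ← inter_iUnion, hDU, inter_univ]
    · exact fun i j hij => ((disjoint_disjointed _ hij).mono inter_subset_right inter_subset_right)
    · exact fun n => hs.inter (hD n)
  refine Measure.le_iff.2 fun s hs => ?_
  rw [key μ s hs, key ν s hs]
  refine ENNReal.tsum_le_tsum fun n => hle (e n) _ ?_ (hs.inter (hD n))
  exact inter_subset_right.trans ((disjointed_subset _ n).trans interior_subset)

theorem ENNReal.le_of_forall_one_lt_le_pow_mul {a b : ℝ≥0∞} (m : ℕ)
    (h : ∀ K : ℝ≥0, 1 < K → a ≤ (K : ℝ≥0∞) ^ m * b) : a ≤ b := by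
  have ht : Tendsto (fun K : ℝ≥0 => (K : ℝ≥0∞) ^ m * b) (𝓝[>] 1) (𝓝 (1 * b)) := by
    refine ENNReal.Tendsto.mul_const ?_ (Or.inl one_ne_zero)
    refine Tendsto.mono_left ?_ nhdsWithin_le_nhds
    have : Continuous fun K : ℝ≥0 => (K : ℝ≥0∞) ^ m := by fun_prop
    simpa using this.tendsto 1
  rw [one_mul] at ht
  exact ge_of_tendsto ht (eventually_nhdsWithin_of_forall fun K hK => h K hK)

section AreaFormula

variable {U V : Type*} [NormedAddCommGroup U] [InnerProductSpace ℝ U] [FiniteDimensional ℝ U]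
  [NormedAddCommGroup V] [InnerProductSpace ℝ V]

theorem ContinuousLinearMap.continuous_normDet [FiniteDimensional ℝ V] :
    Continuous fun A : U →L[ℝ] V => (A : U →ₗ[ℝ] V).normDet := by
  have : (fun A : U →L[ℝ] V => (A : U →ₗ[ℝ] V).normDet) =
      fun A => √((A.adjoint ∘L A).det) := by
    ext A
    rw [← ContinuousLinearMap.normDet_sq]
    exact (Real.sqrt_sq (LinearMap.normDet_nonneg _)).symm
  rw [this]
  refine Real.continuous_sqrt.comp (ContinuousLinearMap.continuous_det.comp ?_)
  exact (ContinuousLinearMap.adjoint.continuous).clm_comp continuous_id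

theorem HasStrictFDerivAt.exists_nhds_edist_le {φ : U → V} {A : U →L[ℝ] V} {u₀ : U}
    (h : HasStrictFDerivAt φ A u₀) (hA : Function.Injective A) {K : ℝ≥0} (hK : 1 < K) :
    ∃ W ∈ 𝓝 u₀, ∀ u ∈ W, ∀ v ∈ W, edist (φ u) (φ v) ≤ K * edist (A u) (A v) ∧
      edist (A u) (A v) ≤ K * edist (φ u) (φ v) := by
  obtain ⟨C, hC, hanti⟩ := (A : U →ₗ[ℝ] V).exists_antilipschitzWith (LinearMap.ker_eq_bot.2 hA)
  have hK' : (1 : ℝ) < K := hK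
  have hη : 0 < (1 - (K : ℝ)⁻¹) / C :=
    div_pos (sub_pos.2 (inv_lt_one_of_one_lt₀ hK')) hC
  have := (h.isLittleO.def hη)
  rw [nhds_prod_eq] at this
  obtain ⟨W, hW, hWW⟩ := eventually_prod_self_iff'.1 this
  refine ⟨W, hW, fun u hu v hv => ?_⟩
  have h1 : ‖φ u - φ v - A (u - v)‖ ≤ (1 - (K : ℝ)⁻¹) / C * ‖u - v‖ := hWW u hu v hv
  have h2 : ‖u - v‖ ≤ C * ‖A (u - v)‖ := by
    have := hanti.le_mul_dist u v
    rwa [dist_eq_norm, dist_eq_norm, ← map_sub] at this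
  have h3 : ‖φ u - φ v - A (u - v)‖ ≤ (1 - (K : ℝ)⁻¹) * ‖A (u - v)‖ := by
    refine h1.trans ?_
    rw [div_mul_eq_mul_div, div_le_iff₀ (by exact_mod_cast hC), mul_assoc]
    refine mul_le_mul_of_nonneg_left ?_ (sub_pos.2 (inv_lt_one_of_one_lt₀ hK')).le
    linarith
  have h4 : ‖φ u - φ v‖ ≤ ‖φ u - φ v - A (u - v)‖ + ‖A (u - v)‖ := norm_le_norm_sub_add _ _
  have h5 : ‖A (u - v)‖ ≤ ‖φ u - φ v - A (u - v)‖ + ‖φ u - φ v‖ := by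
    rw [norm_sub_rev]; exact norm_le_norm_sub_add _ _
  have h6 : 2 ≤ (K : ℝ) + (K : ℝ)⁻¹ := by
    have : (K : ℝ) * (K : ℝ)⁻¹ = 1 := mul_inv_cancel₀ (by positivity)
    nlinarith [sq_nonneg ((K : ℝ) - 1), inv_pos.2 (zero_lt_one.trans hK')]
  have e1 : dist (φ u) (φ v) ≤ K * dist (A u) (A v) := by
    rw [dist_eq_norm, dist_eq_norm, ← map_sub]
    nlinarith [norm_nonneg (A (u - v))]
  have e2 : dist (A u) (A v) ≤ K * dist (φ u) (φ v) := by
    rw [dist_eq_norm, dist_eq_norm, ← map_sub]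
    have : (K : ℝ)⁻¹ * ‖A (u - v)‖ ≤ ‖φ u - φ v‖ := by linarith
    rwa [inv_mul_le_iff₀ (by positivity)] at this
  constructor
  · rw [edist_nndist, edist_nndist]; exact_mod_cast e1
  · rw [edist_nndist, edist_nndist]; exact_mod_cast e2

variable [FiniteDimensional ℝ V] [MeasurableSpace U] [BorelSpace U]
  [MeasurableSpace V] [BorelSpace V]

theorem ContDiff.exists_nhds_hausdorffMeasure_image_le {φ : U → V} (hφ : ContDiff ℝ 1 φ)
    (u₀ : U) (hinj : Function.Injective (fderiv ℝ φ u₀)) {K : ℝ≥0} (hK : 1 < K) :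
    ∃ W ∈ 𝓝 u₀, ∀ s ⊆ W, MeasurableSet s →
      μH[finrank ℝ U] (φ '' s) ≤ (K : ℝ≥0∞) ^ (finrank ℝ U + 1) *
        ∫⁻ u in s, ENNReal.ofReal (fderiv ℝ φ u : U →ₗ[ℝ] V).normDet ∂μH[finrank ℝ U] ∧
      ∫⁻ u in s, ENNReal.ofReal (fderiv ℝ φ u : U →ₗ[ℝ] V).normDet ∂μH[finrank ℝ U] ≤
        (K : ℝ≥0∞) ^ (finrank ℝ U + 1) * μH[finrank ℝ U] (φ '' s) := by
  have hK' : (1 : ℝ) < K := hK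
  have hK0 : (0 : ℝ) < K := zero_lt_one.trans hK'
  obtain ⟨W, hW, hWW⟩ := (hφ.contDiffAt.hasStrictFDerivAt
    (by simp) : HasStrictFDerivAt φ _ u₀).exists_nhds_edist_le hinj hK
  set J : U → ℝ := fun u => (fderiv ℝ φ u : U →ₗ[ℝ] V).normDet with hJdef
  have hJ : Continuous J :=
    ContinuousLinearMap.continuous_normDet.comp (hφ.continuous_fderiv (by simp))
  have hJ0 : 0 < J u₀ := by
    refine lt_of_le_of_ne (LinearMap.normDet_nonneg _) (Ne.symm ?_)
    exact (LinearMap.normDet_ne_zero_tfae _).out 0 4 |>.2 hinj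
  have hN : ∀ᶠ u in 𝓝 u₀, J u₀ < K * J u ∧ J u < K * J u₀ := by
    refine ((continuous_const.tendsto u₀).eventually_lt
      ((hJ.tendsto u₀).const_mul (K : ℝ)) ?_).and
      ((hJ.tendsto u₀).eventually_lt (continuous_const.tendsto u₀) ?_) <;> nlinarith
  refine ⟨_, inter_mem hW hN, fun s hs hsm => ?_⟩
  have hsW : s ⊆ W := fun u hu => (hs hu).1
  have hsN : ∀ u ∈ s, J u₀ < K * J u ∧ J u < K * J u₀ := fun u hu => (hs hu).2
  have i1 := hausdorffMeasure_image_le_of_edist_le (d := finrank ℝ U) (by positivity)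
    (fun u hu v hv => (hWW u (hsW hu) v (hsW hv)).1)
  have i2 := hausdorffMeasure_image_le_of_edist_le (d := finrank ℝ U) (by positivity)
    (fun u hu v hv => (hWW u (hsW hu) v (hsW hv)).2)
  have i3 := LinearMap.hausdorffMeasure_image (fderiv ℝ φ u₀ : U →ₗ[ℝ] V) s
  have i4 : ENNReal.ofReal (J u₀) * μH[finrank ℝ U] s ≤
      K * ∫⁻ u in s, ENNReal.ofReal (J u) ∂μH[finrank ℝ U] := by
    rw [← setLIntegral_const, ← lintegral_const_mul' _ _ ENNReal.coe_ne_top]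
    refine setLIntegral_mono' hsm fun u hu => ?_
    rw [← ENNReal.ofReal_coe_nnreal, ← ENNReal.ofReal_mul hK0.le]
    exact ENNReal.ofReal_le_ofReal (hsN u hu).1.le
  have i5 : ∫⁻ u in s, ENNReal.ofReal (J u) ∂μH[finrank ℝ U] ≤
      K * (ENNReal.ofReal (J u₀) * μH[finrank ℝ U] s) := by
    rw [← mul_assoc, ← setLIntegral_const]
    refine setLIntegral_mono' hsm fun u hu => ?_
    rw [← ENNReal.ofReal_coe_nnreal, ← ENNReal.ofReal_mul hK0.le]
    exact ENNReal.ofReal_le_ofReal (hsN u hu).2.le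
  simp only [ENNReal.rpow_natCast] at i1 i2
  change μH[finrank ℝ U] (fderiv ℝ φ u₀ '' s) = ENNReal.ofReal (J u₀) * _ at i3
  rw [i3] at i1 i2
  constructor
  · refine i1.trans ?_
    rw [pow_succ, mul_assoc]
    gcongr
  · refine i5.trans ?_
    rw [pow_succ', mul_assoc]
    gcongr

/-- The area formula for an injective immersion of class `C¹`. -/
theorem ContDiff.comap_hausdorffMeasure_eq_withDensity {φ : U → V} (hφ : ContDiff ℝ 1 φ)
    (hinj : Function.Injective φ) (hinj' : ∀ u, Function.Injective (fderiv ℝ φ u)) :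
    (μH[finrank ℝ U] : Measure V).comap φ = (μH[finrank ℝ U] : Measure U).withDensity
      fun u => ENNReal.ofReal (fderiv ℝ φ u : U →ₗ[ℝ] V).normDet := by
  have hemb : MeasurableEmbedding φ := hφ.continuous.measurableEmbedding hinj
  set J : U → ℝ≥0∞ := fun u => ENNReal.ofReal (fderiv ℝ φ u : U →ₗ[ℝ] V).normDet
  have key : ∀ K : ℝ≥0, 1 < K →
      (μH[finrank ℝ U] : Measure V).comap φ ≤
        (K : ℝ≥0∞) ^ (finrank ℝ U + 1) • (μH[finrank ℝ U] : Measure U).withDensity J ∧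
      (μH[finrank ℝ U] : Measure U).withDensity J ≤
        (K : ℝ≥0∞) ^ (finrank ℝ U + 1) • (μH[finrank ℝ U] : Measure V).comap φ := by
    intro K hK
    constructor <;> refine Measure.le_of_locally_le fun u₀ => ?_ <;>
    · obtain ⟨W, hW, h⟩ := hφ.exists_nhds_hausdorffMeasure_image_le u₀ (hinj' u₀) hK
      refine ⟨W, hW, fun s hs hsm => ?_⟩
      simp only [Measure.smul_apply, smul_eq_mul, hemb.comap_apply, withDensity_apply _ hsm]
      first | exact (h s hs hsm).1 | exact (h s hs hsm).2
  refine le_antisymm (Measure.le_iff.2 fun s _ => ?_) (Measure.le_iff.2 fun s _ => ?_)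
  · exact ENNReal.le_of_forall_one_lt_le_pow_mul _ fun K hK => (key K hK).1 s
  · exact ENNReal.le_of_forall_one_lt_le_pow_mul _ fun K hK => (key K hK).2 s

theorem ContDiff.setLIntegral_range_hausdorffMeasure {φ : U → V} (hφ : ContDiff ℝ 1 φ)
    (hinj : Function.Injective φ) (hinj' : ∀ u, Function.Injective (fderiv ℝ φ u))
    (g : V → ℝ≥0∞) :
    ∫⁻ y in range φ, g y ∂μH[finrank ℝ U] =
      ∫⁻ u, ENNReal.ofReal (fderiv ℝ φ u : U →ₗ[ℝ] V).normDet * g (φ u) ∂μH[finrank ℝ U] := by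
  have hemb : MeasurableEmbedding φ := hφ.continuous.measurableEmbedding hinj
  rw [← hemb.map_comap, hemb.lintegral_map, hφ.comap_hausdorffMeasure_eq_withDensity hinj hinj',
    lintegral_withDensity_eq_lintegral_mul_non_measurable]
  · rfl
  · exact (ENNReal.continuous_ofReal.comp (ContinuousLinearMap.continuous_normDet.comp
      (hφ.continuous_fderiv (by simp)))).measurable
  · exact ae_of_all _ fun _ => ENNReal.ofReal_lt_top

end AreaFormula

section NormDet

variable {d : ℕ} {V : Type*} [NormedAddCommGroup V] [InnerProductSpace ℝ V]
  [FiniteDimensional ℝ V]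

theorem Matrix.det_gram_cons_eq_sq_mul_sq_normDet (hV : finrank ℝ V = d + 1)
    (A : EuclideanSpace ℝ (Fin d) →ₗ[ℝ] V) (w : V) {N : V} (hN : ‖N‖ = 1)
    (hA : ∀ h, ⟪N, A h⟫ = 0) :
    (Matrix.gram ℝ (Fin.cons w fun j => A (EuclideanSpace.basisFun (Fin d) ℝ j) :
      Fin (d + 1) → V)).det = ⟪N, w⟫ ^ 2 * A.normDet ^ 2 := by
  obtain ⟨b, hb⟩ := Orthonormal.exists_orthonormalBasis_extension_of_card_eq
    (ι := Fin (d + 1)) (𝕜 := ℝ) (E := V) (by simpa using hV) (v := fun _ => N) (s := {0})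
    (by
      rw [orthonormal_iff_ite]
      rintro ⟨i, rfl⟩ ⟨j, rfl⟩
      simp [hN])
  have hb0 : b 0 = N := hb 0 rfl
  have hsq := A.normDet_sq_eq_det_gram (EuclideanSpace.basisFun (Fin d) ℝ)
  rw [Matrix.gram_eq_conjTranspose_mul b, Matrix.det_mul, Matrix.det_conjTranspose]
  simp only [RCLike.ofReal_real_eq_id, id] at hsq
  rw [hsq]
  set M : Matrix (Fin (d + 1)) (Fin (d + 1)) ℝ := Matrix.of fun i j =>
    b.repr ((Fin.cons w fun j => A (EuclideanSpace.basisFun (Fin d) ℝ j) :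
      Fin (d + 1) → V) j) i with hM
  set M' : Matrix (Fin d) (Fin d) ℝ := Matrix.of fun i j =>
    b.repr (A (EuclideanSpace.basisFun (Fin d) ℝ j)) i.succ with hM'
  have h1 : M.det = ⟪N, w⟫ * M'.det := by
    rw [Matrix.det_succ_row_zero, Fin.sum_univ_succ]
    have : ∀ j : Fin d, M 0 j.succ = 0 := fun j => by
      simp [hM, b.repr_apply_apply, hb0, hA]
    simp only [this, mul_zero, zero_mul, Finset.sum_const_zero, add_zero]
    have h0 : M 0 0 = ⟪N, w⟫ := by simp [hM, b.repr_apply_apply, hb0]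
    have h2 : M.submatrix Fin.succ (Fin.succAbove 0) = M' := by
      ext i j
      simp [hM, hM']
    rw [h0, h2]
    simp
  have h2 : Matrix.gram ℝ (fun j => A (EuclideanSpace.basisFun (Fin d) ℝ j)) =
      M'.transpose * M' := by
    ext i j
    rw [Matrix.gram_apply, ← b.sum_inner_mul_inner, Fin.sum_univ_succ, Matrix.mul_apply]
    rw [hb0, hA, mul_zero, zero_add]
    refine Finset.sum_congr rfl fun k _ => ?_
    simp only [hM', Matrix.transpose_apply, Matrix.of_apply, b.repr_apply_apply]
    rw [real_inner_comm]
  rw [h1, h2, Matrix.det_mul, Matrix.det_transpose]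
  simp only [star_trivial]
  ring

theorem Matrix.det_gram_cons_smul_add_smul (hV : finrank ℝ V = d + 1)
    (w : V) (v : Fin d → V) (s : ℝ) (l : Fin d → ℝ) :
    (Matrix.gram ℝ (Fin.cons w fun j => s • v j + l j • w : Fin (d + 1) → V)).det =
      (s ^ d) ^ 2 * (Matrix.gram ℝ (Fin.cons w v : Fin (d + 1) → V)).det := by
  let b : OrthonormalBasis (Fin (d + 1)) ℝ V :=
    (stdOrthonormalBasis ℝ V).reindex (finCongr hV)
  have key : ∀ u : Fin (d + 1) → V, (Matrix.gram ℝ u).det =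
      (Matrix.of fun i j => b.repr (u i) j).det ^ 2 := by
    intro u
    rw [Matrix.gram_eq_conjTranspose_mul b, Matrix.det_mul, Matrix.det_conjTranspose, star_trivial,
      ← sq, ← Matrix.det_transpose]
    rfl
  rw [key, key, ← mul_pow]
  congr 1
  set B : Matrix (Fin (d + 1)) (Fin (d + 1)) ℝ :=
    Matrix.of fun i j => b.repr ((Fin.cons w v : Fin (d + 1) → V) i) j with hB
  set t : Fin (d + 1) → ℝ := Fin.cons 1 fun _ => s with ht
  have h1 : ∏ i, t i = s ^ d := by simp [Fin.prod_univ_succ, ht]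
  rw [← h1, ← Matrix.det_mul_column]
  refine Matrix.det_eq_of_forall_row_eq_smul_add_const (Fin.cons 0 l) 0 (by simp) fun i j => ?_
  refine Fin.cases ?_ (fun i => ?_) i
  · simp [hB, ht]
  · simp [hB, ht]

/-- The Jacobian of a map whose derivative is the sum of a homothetic embedding onto `ν`'s
orthogonal complement and of a map along `w`. -/
theorem LinearMap.normDet_mul_abs_inner (hV : finrank ℝ V = d + 1)
    (ι : EuclideanSpace ℝ (Fin d) →ₗᵢ[ℝ] V) {ν w N : V} (hν : ‖ν‖ = 1) (hι : ∀ h, ⟪ν, ι h⟫ = 0)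
    (hw : ⟪ν, w⟫ = -1) (hN : ‖N‖ = 1) {s : ℝ} (hs : 0 ≤ s)
    {A : EuclideanSpace ℝ (Fin d) →ₗ[ℝ] V} {l : EuclideanSpace ℝ (Fin d) → ℝ}
    (hA : ∀ h, A h = s • ι h + l h • w) (hAN : ∀ h, ⟪N, A h⟫ = 0) :
    A.normDet * |⟪N, w⟫| = s ^ d := by
  have h1 := Matrix.det_gram_cons_eq_sq_mul_sq_normDet hV A w hN hAN
  have h2 := Matrix.det_gram_cons_eq_sq_mul_sq_normDet hV ι.toLinearMap w hν hι
  simp only [hA] at h1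
  rw [Matrix.det_gram_cons_smul_add_smul hV] at h1
  rw [LinearIsometry.normDet_eq_one, hw] at h2
  simp only [LinearIsometry.coe_toLinearMap] at h2
  rw [h2] at h1
  refine (sq_eq_sq₀ (mul_nonneg A.normDet_nonneg (abs_nonneg _)) (pow_nonneg hs d)).1 ?_
  rw [mul_pow, sq_abs]
  linarith

end NormDet

section Radial

variable {d : ℕ} {V : Type*} [NormedAddCommGroup V] [InnerProductSpace ℝ V]
  [FiniteDimensional ℝ V] [MeasurableSpace V] [BorelSpace V]

/-- The kernel integral over a radial graph `z ↦ x + r z • (ι z - ν)` contained in a level set of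
`F` does not depend on the graph. -/
theorem setLIntegral_range_radial (hV : finrank ℝ V = d + 1)
    (ι : EuclideanSpace ℝ (Fin d) →ₗᵢ[ℝ] V) {ν : V} (hν : ‖ν‖ = 1) (hι : ∀ h, ⟪ν, ι h⟫ = 0)
    (x : V) {r : EuclideanSpace ℝ (Fin d) → ℝ} (hr : ContDiff ℝ 1 r) (hr0 : ∀ z, 0 < r z)
    {F : V → ℝ} {G : V → V} (hFG : ∀ y, HasGradientAt F (G y) y)
    (hF : ∀ z, F (x + r z • (ι z - ν)) = 0)
    (hG : ∀ z, ⟪G (x + r z • (ι z - ν)), ι z - ν⟫ ≠ 0) :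
    ∫⁻ y in range fun z => x + r z • (ι z - ν),
        ENNReal.ofReal (|⟪ν, y - x⟫ * ⟪y - x, ‖G y‖⁻¹ • G y⟫| / ‖x - y‖ ^ (d + 2)) ∂μH[d] =
      ∫⁻ z, ENNReal.ofReal ((‖ι z - ν‖ ^ (d + 2))⁻¹) ∂μH[d] := by
  set φ : EuclideanSpace ℝ (Fin d) → V := fun z => x + r z • (ι z - ν) with hφdef
  have hνν : ⟪ν, ν⟫ = 1 := by rw [real_inner_self_eq_norm_sq, hν, one_pow]
  have hw : ∀ z, ⟪ν, ι z - ν⟫ = -1 := fun z => by rw [inner_sub_right, hι, hνν]; norm_num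
  have hφx : ∀ z, φ z - x = r z • (ι z - ν) := fun z => add_sub_cancel_left _ _
  have hφ : ContDiff ℝ 1 φ :=
    contDiff_const.add (hr.smul ((ι.contDiff).sub contDiff_const))
  have hφinj : Function.Injective φ := by
    intro z z' h
    have h1 : r z • (ι z - ν) = r z' • (ι z' - ν) := by rw [← hφx, ← hφx, h]
    have h2 : r z = r z' := by
      have := congrArg (fun v => ⟪ν, v⟫) h1
      simpa [inner_smul_right, hw] using this
    rw [h2] at h1
    exact ι.injective (sub_left_injective (smul_right_injective V (hr0 z').ne' h1))
  have hφ' : ∀ z h, fderiv ℝ φ z h = r z • ι h + fderiv ℝ r z h • (ι z - ν) := by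
    intro z h
    have h1 : HasFDerivAt φ _ z := (((hr.differentiable (by simp)) z).hasFDerivAt.smul
      (ι.toContinuousLinearMap.hasFDerivAt.sub_const ν)).const_add x
    rw [h1.fderiv]
    simp
  have hGφ' : ∀ z h, ⟪G (φ z), fderiv ℝ φ z h⟫ = 0 := by
    intro z h
    have h1 : HasFDerivAt (F ∘ φ) _ z := (hFG (φ z)).hasFDerivAt.comp z
      ((hφ.differentiable (by simp)) z).hasFDerivAt
    have h2 : F ∘ φ = fun _ => 0 := funext hF
    rw [h2] at h1
    have := congrArg (fun L => L h) (h1.unique (hasFDerivAt_const (0 : ℝ) z))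
    simpa using this
  have hG0 : ∀ z, ‖G (φ z)‖ ≠ 0 := fun z h => hG z (by
    change ⟪G (φ z), _⟫ = 0
    rw [norm_eq_zero.1 h, inner_zero_left])
  have hJ : ∀ z, (fderiv ℝ φ z : EuclideanSpace ℝ (Fin d) →ₗ[ℝ] V).normDet *
      |⟪‖G (φ z)‖⁻¹ • G (φ z), ι z - ν⟫| = r z ^ d := by
    intro z
    refine LinearMap.normDet_mul_abs_inner hV ι hν hι (hw z) ?_ (hr0 z).le (hφ' z) fun h => ?_
    · rw [norm_smul, norm_inv, norm_norm, inv_mul_cancel₀ (hG0 z)]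
    · rw [real_inner_smul_left]
      exact mul_eq_zero_of_right _ (hGφ' z h)
  have hφinj' : ∀ z, Function.Injective (fderiv ℝ φ z) := fun z =>
    (LinearMap.normDet_ne_zero_tfae _).out 0 4 |>.1 fun h => by
      have := hJ z
      rw [h, zero_mul] at this
      exact (pow_pos (hr0 z) d).ne this
  have harea := hφ.setLIntegral_range_hausdorffMeasure hφinj hφinj' fun y =>
    ENNReal.ofReal (|⟪ν, y - x⟫ * ⟪y - x, ‖G y‖⁻¹ • G y⟫| / ‖x - y‖ ^ (d + 2))
  rw [finrank_euclideanSpace_fin] at harea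
  rw [harea]
  refine lintegral_congr fun z => ?_
  rw [← ENNReal.ofReal_mul (LinearMap.normDet_nonneg _)]
  congr 1
  have hw0 : ‖ι z - ν‖ ≠ 0 := fun h => by
    have := hw z
    rw [norm_eq_zero.1 h, inner_zero_right] at this
    norm_num at this
  rw [norm_sub_rev, hφx, norm_smul, Real.norm_of_nonneg (hr0 z).le, real_inner_smul_right, hw,
    real_inner_smul_left, real_inner_comm, abs_mul, abs_mul, abs_mul, abs_neg, abs_one,
    abs_of_pos (hr0 z)]
  have h3 := hJ z
  have hr' := (hr0 z).ne'
  generalize |⟪‖G (φ z)‖⁻¹ • G (φ z), ι z - ν⟫| = a at h3 ⊢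
  field_simp
  rw [mul_pow, pow_add (r z)]
  linear_combination (r z ^ 2 * ‖ι z - ν‖ ^ (d + 2)) * h3

end Radial

theorem MeasureTheory.setLIntegral_eq_of_subset_of_forall_diff_eq_zero {X : Type*}
    [MeasurableSpace X] {μ : Measure X} {s t : Set X} {g : X → ℝ≥0∞} (hs : MeasurableSet s)
    (ht : MeasurableSet t) (hst : s ⊆ t) (hg : ∀ x ∈ t, x ∉ s → g x = 0) :
    ∫⁻ x in t, g x ∂μ = ∫⁻ x in s, g x ∂μ := by
  rw [← lintegral_indicator ht, ← lintegral_indicator hs]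
  congr 1
  ext x
  by_cases hxs : x ∈ s
  · simp [hxs, hst hxs]
  · by_cases hxt : x ∈ t
    · simp [hxs, hxt, hg x hxt hxs]
    · simp [hxs, hxt]

section Sphere

variable {d : ℕ} {V : Type*} [NormedAddCommGroup V] [InnerProductSpace ℝ V]

theorem exists_linearIsometry_range_eq_orthogonal (hV : finrank ℝ V = d + 1) {ν : V}
    (hν : ‖ν‖ = 1) :
    ∃ ι : EuclideanSpace ℝ (Fin d) →ₗᵢ[ℝ] V, ∀ v, ⟪ν, v⟫ = 0 ↔ ∃ z, ι z = v := by
  have : Fact (finrank ℝ V = d + 1) := ⟨hV⟩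
  have hν0 : ν ≠ 0 := fun h => by simp [h] at hν
  let b := OrthonormalBasis.fromOrthogonalSpanSingleton (𝕜 := ℝ) d hν0
  refine ⟨(Submodule.subtypeₗᵢ _).comp b.repr.symm.toLinearIsometry, fun v => ?_⟩
  rw [← Submodule.mem_orthogonal_singleton_iff_inner_right]
  constructor
  · intro hv
    exact ⟨b.repr ⟨v, hv⟩, by simp⟩
  · rintro ⟨z, rfl⟩
    exact (b.repr.symm z).2

variable [MeasurableSpace V] [BorelSpace V]

theorem setLIntegral_sphere_inner_comp {a b : V} (hab : ‖a‖ = ‖b‖) (g : ℝ → ℝ≥0∞) (s : ℝ) :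
    ∫⁻ w in Metric.sphere (0 : V) 1, g ⟪a, w⟫ ∂μH[s] =
      ∫⁻ w in Metric.sphere (0 : V) 1, g ⟪b, w⟫ ∂μH[s] := by
  set R : V ≃ₗᵢ[ℝ] V := (ℝ ∙ (a - b))ᗮ.reflection
  have hR : R a = b := Submodule.reflection_sub hab
  have h := (R.toIsometryEquiv.measurePreserving_hausdorffMeasure s).setLIntegral_comp_preimage_emb
    R.toHomeomorph.measurableEmbedding (fun w => g ⟪b, w⟫) (Metric.sphere 0 1)
  rw [← h]
  have : R.toIsometryEquiv ⁻¹' Metric.sphere 0 1 = Metric.sphere 0 1 := by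
    ext w; simp
  rw [this]
  refine lintegral_congr fun w => ?_
  change g _ = g ⟪b, R w⟫
  rw [← hR, R.inner_map_map]

theorem setLIntegral_sphere_abs_inner [FiniteDimensional ℝ V] (hV : finrank ℝ V = d + 1)
    (ι : EuclideanSpace ℝ (Fin d) →ₗᵢ[ℝ] V) {ν : V} (hν : ‖ν‖ = 1)
    (hι : ∀ v, ⟪ν, v⟫ = 0 ↔ ∃ z, ι z = v) {a : V} (ha : ‖a‖ = 1) :
    ∫⁻ w in Metric.sphere (0 : V) 1, ENNReal.ofReal |⟪a, w⟫| ∂μH[d] =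
      2 * ∫⁻ z, ENNReal.ofReal ((‖ι z - ν‖ ^ (d + 2))⁻¹) ∂μH[d] := by
  have hι' : ∀ z, ⟪ν, ι z⟫ = 0 := fun z => (hι _).2 ⟨z, rfl⟩
  have hνν : ⟪ν, ν⟫ = 1 := by rw [real_inner_self_eq_norm_sq, hν, one_pow]
  have hw : ∀ z, ⟪ν, ι z - ν⟫ = -1 := fun z => by rw [inner_sub_right, hι', hνν]; norm_num
  have hw0 : ∀ z, ι z - ν ≠ 0 := fun z h => by
    have := hw z
    rw [h, inner_zero_right] at this
    norm_num at this
  have hw0' : ∀ z, ‖ι z - ν‖ ≠ 0 := fun z => norm_ne_zero_iff.2 (hw0 z)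
  have hnorm : ∀ z, ‖(0 : V) + ‖ι z - ν‖⁻¹ • (ι z - ν)‖ = 1 := fun z => by
    rw [zero_add, norm_smul, norm_inv, norm_norm, inv_mul_cancel₀ (hw0' z)]
  have hmain := setLIntegral_range_radial hV ι hν hι' 0 (r := fun z => ‖ι z - ν‖⁻¹)
    (((ι.contDiff.sub contDiff_const).norm ℝ hw0).inv hw0')
    (fun z => inv_pos.2 (norm_pos_iff.2 (hw0 z)))
    (F := fun y => ‖y‖ ^ 2 - 1) (G := fun y => (2 : ℝ) • y)
    (fun y => by
      have h := (hasStrictFDerivAt_norm_sq y).hasFDerivAt.sub_const 1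
      have e : InnerProductSpace.toDual ℝ V ((2 : ℝ) • y) = 2 • innerSL ℝ y := by
        ext v
        simp [two_mul]
      rw [hasGradientAt_iff_hasFDerivAt, e]
      exact h)
    (fun z => by rw [hnorm]; norm_num)
    (fun z => by
      rw [zero_add, smul_smul, real_inner_smul_left, real_inner_self_eq_norm_sq]
      have := hw0' z
      positivity)
  have hrange : (range fun z => (0 : V) + ‖ι z - ν‖⁻¹ • (ι z - ν)) =
      Metric.sphere 0 1 ∩ {w | ⟪ν, w⟫ < 0} := by
    ext w
    constructor
    · rintro ⟨z, rfl⟩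
      refine ⟨by simpa using hnorm z, ?_⟩
      simp only [mem_ofPred_eq, zero_add, real_inner_smul_right, hw]
      have := norm_pos_iff.2 (hw0 z)
      simpa using hw0 z
    · rintro ⟨hw1, hw2⟩
      have hw1 : ‖w‖ = 1 := by simpa using hw1
      have hw2 : ⟪ν, w⟫ < 0 := hw2
      obtain ⟨z, hz⟩ := (hι ((-⟪ν, w⟫)⁻¹ • w + ν)).1 (by
        rw [inner_add_right, real_inner_smul_right, hνν]
        field_simp [hw2.ne]
        ring)
      refine ⟨z, ?_⟩
      simp only [hz, add_sub_cancel_right, zero_add, norm_smul, hw1, norm_inv, norm_neg, mul_one,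
        inv_inv, smul_smul]
      rw [Real.norm_of_nonpos hw2.le, mul_inv_cancel₀ (neg_ne_zero.2 hw2.ne), one_smul]
  have hmeas : MeasurableSet (Metric.sphere (0 : V) 1 ∩ {w | ⟪ν, w⟫ < 0}) :=
    Metric.isClosed_sphere.measurableSet.inter
      (measurableSet_lt (measurable_const.inner measurable_id) measurable_const)
  have hhalf : ∫⁻ w in Metric.sphere (0 : V) 1, ENNReal.ofReal (-⟪ν, w⟫) ∂μH[d] =
      ∫⁻ z, ENNReal.ofReal ((‖ι z - ν‖ ^ (d + 2))⁻¹) ∂μH[d] := by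
    rw [← hmain, hrange, setLIntegral_eq_of_subset_of_forall_diff_eq_zero hmeas
      Metric.isClosed_sphere.measurableSet inter_subset_left]
    · refine setLIntegral_congr_fun hmeas fun w hw => ?_
      have hw1 : ‖w‖ = 1 := by simpa using hw.1
      have hw2 : ⟪ν, w⟫ < 0 := hw.2
      have h2 : ‖(2 : ℝ) • w‖⁻¹ • (2 : ℝ) • w = w := by
        rw [norm_smul, hw1, smul_smul]
        norm_num
      simp only [sub_zero, zero_sub, norm_neg, h2]
      rw [hw1, real_inner_self_eq_norm_sq, hw1, abs_mul, abs_of_neg hw2]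
      norm_num
    · intro w hw1 hw2
      refine ENNReal.ofReal_eq_zero.2 (neg_nonpos.2 (not_lt.1 fun h => hw2 ⟨hw1, h⟩))
  rw [setLIntegral_sphere_inner_comp (ha.trans hν.symm) (fun t => ENNReal.ofReal |t|), two_mul]
  nth_rewrite 1 [← hhalf]
  rw [← hhalf]
  have hneg := setLIntegral_sphere_inner_comp (norm_neg ν) (fun t => ENNReal.ofReal t) d
  simp only [inner_neg_left] at hneg
  nth_rewrite 2 [hneg]
  rw [← lintegral_add_left (by fun_prop)]
  refine lintegral_congr fun w => ?_
  rcases le_total 0 ⟪ν, w⟫ with h | h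
  · rw [abs_of_nonneg h, ENNReal.ofReal_eq_zero.2 (neg_nonpos.2 h), zero_add]
  · rw [abs_of_nonpos h, ENNReal.ofReal_eq_zero.2 h, add_zero]

end Sphere

section Convex

variable {V : Type*} [NormedAddCommGroup V] [NormedSpace ℝ V] {Ω : Set V} {f : V → ℝ}

theorem IsOpen.exists_pos_smul_add_mem (hΩ : IsOpen Ω) {p : V} (hp : p ∈ Ω) (v : V) :
    ∃ ε > (0 : ℝ), p + ε • v ∈ Ω := by
  have h : Tendsto (fun t : ℝ => p + t • v) (𝓝[>] 0) (𝓝 p) := by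
    have : Continuous fun t : ℝ => p + t • v := by fun_prop
    simpa using (this.tendsto 0).mono_left nhdsWithin_le_nhds
  obtain ⟨ε, h1, h2⟩ := ((h.eventually (hΩ.mem_nhds hp)).and self_mem_nhdsWithin).exists
  exact ⟨ε, h2, h1⟩

theorem Convex.add_smul_mem_of_isOpen (hconv : Convex ℝ Ω) (hopen : IsOpen Ω) {y v : V}
    (hy : y ∈ closure Ω) {s t : ℝ} (ht : 0 < t) (hts : t ≤ s) (hs : y + s • v ∈ Ω) :
    y + t • v ∈ Ω := by
  have h := hconv.add_smul_sub_mem_interior' hy (hopen.interior_eq.symm ▸ hs)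
    (t := t / s) ⟨div_pos ht (ht.trans_le hts), (div_le_one (ht.trans_le hts)).2 hts⟩
  rw [hopen.interior_eq, add_sub_cancel_left, smul_smul,
    div_mul_cancel₀ _ (ht.trans_le hts).ne'] at h
  exact h

theorem Convex.fderiv_sub_nonpos (hconv : Convex ℝ Ω) (hopen : IsOpen Ω)
    (hΩ : ∀ z ∈ Ω, f z < 0) {p y : V} (hy : y ∈ closure Ω) (hfy : f y = 0)
    (hf : DifferentiableAt ℝ f y) (hp : p ∈ Ω) : fderiv ℝ f y (p - y) ≤ 0 := by
  have hline : HasDerivAt (fun t : ℝ => f (y + t • (p - y))) (fderiv ℝ f y (p - y)) 0 := by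
    have h1 : HasDerivAt (fun t : ℝ => y + t • (p - y)) (p - y) 0 := by
      simpa using ((hasDerivAt_id (0 : ℝ)).smul_const (p - y)).const_add y
    have h2 : HasFDerivAt f (fderiv ℝ f y) (y + (0 : ℝ) • (p - y)) := by
      simpa using hf.hasFDerivAt
    exact h2.comp_hasDerivAt (0 : ℝ) h1
  refine le_of_tendsto hline.tendsto_slope_zero_right ?_
  filter_upwards [Ioo_mem_nhdsGT (zero_lt_one' ℝ)] with t ht
  have hmem := hconv.add_smul_mem_of_isOpen hopen hy (v := p - y) ht.1 ht.2.le (by simpa using hp)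
  simp only [zero_add, zero_smul, add_zero, hfy, sub_zero, smul_eq_mul]
  exact mul_nonpos_of_nonneg_of_nonpos (inv_nonneg.2 ht.1.le) (hΩ _ hmem).le

theorem Convex.fderiv_sub_neg (hconv : Convex ℝ Ω) (hopen : IsOpen Ω)
    (hΩ : ∀ z ∈ Ω, f z < 0) {p y : V} (hy : y ∈ closure Ω) (hfy : f y = 0)
    (hf : fderiv ℝ f y ≠ 0) (hp : p ∈ Ω) : fderiv ℝ f y (p - y) < 0 := by
  have hd : DifferentiableAt ℝ f y := by
    by_contra h
    exact hf (fderiv_zero_of_not_differentiableAt h)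
  refine (hconv.fderiv_sub_nonpos hopen hΩ hy hfy hd hp).lt_of_ne fun h0 => ?_
  obtain ⟨v, hv⟩ : ∃ v, 0 < fderiv ℝ f y v := by
    by_contra! h
    refine hf (ContinuousLinearMap.ext fun v => le_antisymm (h v) ?_)
    simpa using h (-v)
  obtain ⟨ε, hε, hεv⟩ := hopen.exists_pos_smul_add_mem hp v
  have := hconv.fderiv_sub_nonpos hopen hΩ hy hfy hd hεv
  rw [add_sub_right_comm, map_add, h0, map_smul, smul_eq_mul, zero_add] at this
  exact absurd this (not_le.2 (by positivity))

/-- `Ω` is a bounded convex set with `C¹` boundary and defining function `f`. -/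
structure IsConvexSublevel (Ω : Set V) (f : V → ℝ) : Prop where
  convex : Convex ℝ Ω
  isBounded : Bornology.IsBounded Ω
  contDiff : ContDiff ℝ 1 f
  eq_setOf : Ω = {x | f x < 0}
  frontier_eq : frontier Ω = {x | f x = 0}
  fderiv_ne_zero : ∀ x ∈ frontier Ω, fderiv ℝ f x ≠ 0

namespace IsConvexSublevel

variable {x y v : V}

theorem mem_iff (h : IsConvexSublevel Ω f) : x ∈ Ω ↔ f x < 0 := by
  rw [h.eq_setOf]; rfl

theorem mem_frontier_iff (h : IsConvexSublevel Ω f) : x ∈ frontier Ω ↔ f x = 0 := by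
  rw [h.frontier_eq]; rfl

theorem isOpen (h : IsConvexSublevel Ω f) : IsOpen Ω := by
  rw [h.eq_setOf]
  exact isOpen_lt h.contDiff.continuous continuous_const

theorem fderiv_sub_neg (h : IsConvexSublevel Ω f)
    (hy : y ∈ frontier Ω) (hx : x ∈ Ω) : fderiv ℝ f y (x - y) < 0 :=
  h.convex.fderiv_sub_neg h.isOpen (fun _ => h.mem_iff.1) (frontier_subset_closure hy)
    (h.mem_frontier_iff.1 hy) (h.fderiv_ne_zero y hy) hx

theorem fderiv_sub_nonpos (h : IsConvexSublevel Ω f) (hx : x ∈ frontier Ω) (hy : y ∈ frontier Ω) :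
    fderiv ℝ f x (y - x) ≤ 0 := by
  refine closure_minimal (s := Ω) (t := {y | fderiv ℝ f x (y - x) ≤ 0})
    (fun p hp => (h.fderiv_sub_neg hx hp).le) ?_ (frontier_subset_closure hy)
  exact isClosed_le (by fun_prop) continuous_const

theorem exists_add_smul_mem (h : IsConvexSublevel Ω f)
    (hx : x ∈ frontier Ω) (hv : fderiv ℝ f x v < 0) :
    ∃ t > (0 : ℝ), x + t • v ∈ Ω := by
  have hline : HasDerivAt (fun t : ℝ => f (x + t • v)) (fderiv ℝ f x v) 0 := by
    have h1 : HasDerivAt (fun t : ℝ => x + t • v) v 0 := by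
      simpa using ((hasDerivAt_id (0 : ℝ)).smul_const v).const_add x
    have h2 : HasFDerivAt f (fderiv ℝ f x) (x + (0 : ℝ) • v) := by
      simpa using (h.contDiff.differentiable one_ne_zero x).hasFDerivAt
    exact h2.comp_hasDerivAt (0 : ℝ) h1
  obtain ⟨t, ht, ht0⟩ := ((hline.tendsto_slope_zero_right.eventually
    (gt_mem_nhds hv)).and self_mem_nhdsWithin).exists
  have ht0 : 0 < t := ht0
  refine ⟨t, ht0, h.mem_iff.2 ?_⟩
  simp only [zero_add, zero_smul, add_zero, h.mem_frontier_iff.1 hx, sub_zero, smul_eq_mul] at ht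
  by_contra! hf
  exact absurd ht (not_lt.2 (by positivity))

theorem add_smul_mem_of_lt (h : IsConvexSublevel Ω f)
    (hx : x ∈ frontier Ω) (hv : fderiv ℝ f x v < 0) {s t : ℝ}
    (hs : 0 < s) (hst : s < t) (ht : x + t • v ∈ frontier Ω) : x + s • v ∈ Ω := by
  obtain ⟨u, hu, hmem⟩ := h.exists_add_smul_mem hx hv
  rcases le_or_gt s u with hsu | hus
  · exact h.convex.add_smul_mem_of_isOpen h.isOpen (frontier_subset_closure hx) hs hsu hmem
  · have e : x + s • v = x + t • v + (t - s) • (-v) := by module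
    rw [e]
    refine h.convex.add_smul_mem_of_isOpen h.isOpen (frontier_subset_closure ht) (s := t - u)
      (by linarith) (by linarith) ?_
    have e : x + t • v + (t - u) • (-v) = x + u • v := by module
    rwa [e]

theorem existsUnique_add_smul_mem_frontier (h : IsConvexSublevel Ω f)
    (hx : x ∈ frontier Ω) (hv : fderiv ℝ f x v < 0) :
    ∃! t : ℝ, 0 < t ∧ x + t • v ∈ frontier Ω := by
  obtain ⟨u, hu, hmem⟩ := h.exists_add_smul_mem hx hv
  have hv0 : v ≠ 0 := by
    rintro rfl
    simp at hv
  obtain ⟨C, hC⟩ := h.isBounded.exists_norm_le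
  have hlarge : ∃ T, u < T ∧ x + T • v ∉ Ω := by
    refine ⟨u + (C + ‖x + u • v‖ + 1) / ‖v‖, ?_, fun hT => ?_⟩
    · have := (norm_nonneg _).trans (hC _ hmem)
      have := norm_pos_iff.2 hv0
      have := norm_nonneg (x + u • v)
      have : 0 < (C + ‖x + u • v‖ + 1) / ‖v‖ := by positivity
      linarith
    · have h1 := hC _ hT
      have e : x + (u + (C + ‖x + u • v‖ + 1) / ‖v‖) • v =
          ((C + ‖x + u • v‖ + 1) / ‖v‖) • v + (x + u • v) := by module
      have h2 := norm_sub_le_norm_add (((C + ‖x + u • v‖ + 1) / ‖v‖) • v) (x + u • v)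
      rw [← e, norm_smul, norm_div, norm_norm, div_mul_cancel₀ _ (norm_ne_zero_iff.2 hv0)] at h2
      have := Real.le_norm_self (C + ‖x + u • v‖ + 1)
      linarith
  obtain ⟨T, huT, hT⟩ := hlarge
  have hcont : Continuous fun t : ℝ => f (x + t • v) := by
    have := h.contDiff.continuous
    fun_prop
  obtain ⟨t, ht, ht0⟩ := intermediate_value_Icc huT.le hcont.continuousOn
    ⟨(h.mem_iff.1 hmem).le, not_lt.1 fun hh => hT (h.mem_iff.2 hh)⟩
  refine ⟨t, ⟨hu.trans_le ht.1, h.mem_frontier_iff.2 ht0⟩, fun s hs => ?_⟩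
  have key : ∀ {a b : ℝ}, 0 < a → x + a • v ∈ frontier Ω → x + b • v ∈ frontier Ω → b ≤ a := by
    intro a b ha h1 h2
    by_contra! hab
    have := h.mem_iff.1 (h.add_smul_mem_of_lt hx hv ha hab h2)
    rw [h.mem_frontier_iff.1 h1] at this
    exact lt_irrefl _ this
  exact le_antisymm (key (hu.trans_le ht.1) (h.mem_frontier_iff.2 ht0) hs.2)
    (key hs.1 hs.2 (h.mem_frontier_iff.2 ht0))

theorem fderiv_add_smul_pos (h : IsConvexSublevel Ω f)
    (hx : x ∈ frontier Ω) (hv : fderiv ℝ f x v < 0) {t : ℝ}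
    (ht : 0 < t) (hmem : x + t • v ∈ frontier Ω) : 0 < fderiv ℝ f (x + t • v) v := by
  have h1 := h.fderiv_sub_neg hmem (h.add_smul_mem_of_lt hx hv (half_pos ht) (half_lt_self ht) hmem)
  have e : x + (t / 2) • v - (x + t • v) = (-(t / 2)) • v := by module
  rw [e, map_smul, smul_eq_mul] at h1
  by_contra! h2
  nlinarith

/-- The radial function of a convex sublevel set around a boundary point, along a `C¹` family of
inward directions, is `C¹`. -/
theorem exists_contDiff_radial (h : IsConvexSublevel Ω f)
    [CompleteSpace V] {E : Type*} [NormedAddCommGroup E]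
    [NormedSpace ℝ E] [CompleteSpace E] (hx : x ∈ frontier Ω) {w : E → V} (hw : ContDiff ℝ 1 w)
    (hwneg : ∀ z, fderiv ℝ f x (w z) < 0) :
    ∃ r : E → ℝ, ContDiff ℝ 1 r ∧
      ∀ z t, (0 < t ∧ x + t • w z ∈ frontier Ω) ↔ t = r z := by
  choose r hr hru using fun z => h.existsUnique_add_smul_mem_frontier hx (hwneg z)
  refine ⟨r, contDiff_iff_contDiffAt.2 fun z₀ => ?_, fun z t => ⟨hru z t, ?_⟩⟩
  · let Φ : E × ℝ → ℝ := fun q => f (x + q.2 • w q.1)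
    have hΦ : ContDiff ℝ 1 Φ := by
      have := h.contDiff
      fun_prop
    have hΦ0 : Φ (z₀, r z₀) = 0 := h.mem_frontier_iff.1 (hr z₀).2
    have hder : fderiv ℝ Φ (z₀, r z₀) (0, 1) = fderiv ℝ f (x + r z₀ • w z₀) (w z₀) := by
      have h1 : HasDerivAt (fun t : ℝ => Φ (z₀, t)) (fderiv ℝ Φ (z₀, r z₀) (0, 1)) (r z₀) :=
        (hΦ.differentiable one_ne_zero (z₀, r z₀)).hasFDerivAt.comp_hasDerivAt (r z₀)
          ((hasDerivAt_const _ z₀).prodMk (hasDerivAt_id _))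
      have h2 : HasDerivAt (fun t : ℝ => x + t • w z₀) (w z₀) (r z₀) := by
        simpa using ((hasDerivAt_id (r z₀)).smul_const (w z₀)).const_add x
      exact h1.unique ((h.contDiff.differentiable one_ne_zero _).hasFDerivAt.comp_hasDerivAt _ h2)
    have hpos := h.fderiv_add_smul_pos hx (hwneg z₀) (hr z₀).1 (hr z₀).2
    have hinv : (fderiv ℝ Φ (z₀, r z₀) ∘L .inr ℝ E ℝ).IsInvertible := by
      refine ⟨ContinuousLinearEquiv.unitsEquivAut ℝ (Units.mk0 _ hpos.ne'), ?_⟩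
      ext
      simp [hder]
    have hg := hΦ.contDiffAt.contDiffAt_implicitFunction one_ne_zero hinv
    refine hg.congr_of_eventuallyEq ?_
    have hg0 := hΦ.contDiffAt.implicitFunction_apply_self one_ne_zero hinv
    filter_upwards [hΦ.contDiffAt.eventually_apply_implicitFunction one_ne_zero hinv,
      hg.continuousAt.eventually (lt_mem_nhds ((hr z₀).1.trans_eq hg0.symm))] with z hz1 hz2
    exact (hru z _ ⟨hz2, h.mem_frontier_iff.2 (hz1.trans hΦ0)⟩).symm
  · rintro rfl
    exact hr z

end IsConvexSublevel

end Convex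

section Frontier

variable {d : ℕ} {V : Type*} [NormedAddCommGroup V] [InnerProductSpace ℝ V]
  [FiniteDimensional ℝ V] [MeasurableSpace V] [BorelSpace V] {Ω : Set V} {f : V → ℝ}

theorem setLIntegral_frontier_kernel (hV : finrank ℝ V = d + 1)
    (ι : EuclideanSpace ℝ (Fin d) →ₗᵢ[ℝ] V) {ν : V} (hν : ‖ν‖ = 1)
    (hι : ∀ v, ⟪ν, v⟫ = 0 ↔ ∃ z, ι z = v) (h : IsConvexSublevel Ω f) {x : V}
    (hx : x ∈ frontier Ω) (hνx : ν = ‖gradient f x‖⁻¹ • gradient f x) :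
    ∫⁻ y in frontier Ω, ENNReal.ofReal (|⟪ν, y - x⟫ *
        ⟪y - x, ‖gradient f y‖⁻¹ • gradient f y⟫| / ‖x - y‖ ^ (d + 2)) ∂μH[d] =
      ∫⁻ z, ENNReal.ofReal ((‖ι z - ν‖ ^ (d + 2))⁻¹) ∂μH[d] := by
  have hdiff : Differentiable ℝ f := h.contDiff.differentiable one_ne_zero
  have hνν : ⟪ν, ν⟫ = 1 := by rw [real_inner_self_eq_norm_sq, hν, one_pow]
  have hw : ∀ z, ⟪ν, ι z - ν⟫ = -1 := fun z => by
    rw [inner_sub_right, (hι _).2 ⟨z, rfl⟩, hνν, zero_sub]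
  have hG : ∀ y v, ⟪gradient f y, v⟫ = fderiv ℝ f y v := fun y v => by
    rw [gradient, InnerProductSpace.toDual_symm_apply]
  have hGx : 0 < ‖gradient f x‖ := by
    rw [norm_pos_iff]
    intro h0
    simp [hνx, h0] at hν
  have hνG : ∀ v, fderiv ℝ f x v = ‖gradient f x‖ * ⟪ν, v⟫ := fun v => by
    rw [hνx, real_inner_smul_left, mul_inv_cancel_left₀ hGx.ne', hG]
  have hwneg : ∀ z, fderiv ℝ f x (ι z - ν) < 0 := fun z => by
    rw [hνG, hw]
    linarith
  obtain ⟨r, hr, hru⟩ := h.exists_contDiff_radial hx (ι.contDiff.sub contDiff_const) hwneg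
  have hr0 : ∀ z, 0 < r z ∧ x + r z • (ι z - ν) ∈ frontier Ω := fun z => (hru z _).2 rfl
  have hrange : (range fun z => x + r z • (ι z - ν)) =
      frontier Ω ∩ {y | ⟪ν, y - x⟫ < 0} := by
    ext y
    constructor
    · rintro ⟨z, rfl⟩
      refine ⟨(hr0 z).2, ?_⟩
      simpa [real_inner_smul_right, hw] using (hr0 z).1
    · rintro ⟨hy1, hy2⟩
      have hy2 : ⟪ν, y - x⟫ < 0 := hy2
      obtain ⟨z, hz⟩ := (hι ((-⟪ν, y - x⟫)⁻¹ • (y - x) + ν)).1 (by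
        rw [inner_add_right, real_inner_smul_right, hνν]
        field_simp [hy2.ne]
        ring)
      have hy : x + (-⟪ν, y - x⟫) • (ι z - ν) = y := by
        rw [hz, add_sub_cancel_right, smul_inv_smul₀ (neg_ne_zero.2 hy2.ne), add_sub_cancel]
      refine ⟨z, ?_⟩
      simp only [← (hru z _).1 ⟨neg_pos.2 hy2, hy.symm ▸ hy1⟩, hy]
  have hmeas : MeasurableSet (frontier Ω ∩ {y | ⟪ν, y - x⟫ < 0}) :=
    isClosed_frontier.measurableSet.inter
      (measurableSet_lt (by fun_prop) measurable_const)
  rw [setLIntegral_eq_of_subset_of_forall_diff_eq_zero hmeas isClosed_frontier.measurableSet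
    inter_subset_left, ← hrange]
  · refine setLIntegral_range_radial hV ι hν (fun z => (hι _).2 ⟨z, rfl⟩) x hr
      (fun z => (hr0 z).1) (fun y => (hdiff y).hasGradientAt)
      (fun z => h.mem_frontier_iff.1 (hr0 z).2) fun z => ?_
    rw [hG]
    exact (h.fderiv_add_smul_pos hx (hwneg z) (hr0 z).1 (hr0 z).2).ne'
  · intro y hy1 hy2
    have h1 := h.fderiv_sub_nonpos hx hy1
    rw [hνG] at h1
    have h2 : ⟪ν, y - x⟫ = 0 := le_antisymm (nonpos_of_mul_nonpos_right h1 hGx)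
      (not_lt.1 fun hlt => hy2 ⟨hy1, hlt⟩)
    simp [h2]

theorem IsConvexSublevel.setIntegral_frontier_kernel (hV : finrank ℝ V = d + 1)
    (h : IsConvexSublevel Ω f) {ν : V → V}
    (hν : ∀ x ∈ frontier Ω, ν x = ‖gradient f x‖⁻¹ • gradient f x) {x : V}
    (hx : x ∈ frontier Ω) {a : V} (ha : ‖a‖ = 1) :
    ∫ y in frontier Ω, |⟪ν x, y - x⟫ * ⟪y - x, ν y⟫| / ‖x - y‖ ^ (d + 2) ∂μH[d] =
      1 / 2 * ∫ w in Metric.sphere (0 : V) 1, |⟪a, w⟫| ∂μH[d] := by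
  have hGx : gradient f x ≠ 0 := fun h0 =>
    h.fderiv_ne_zero x hx ((InnerProductSpace.toDual ℝ V).symm.map_eq_zero_iff.1 h0)
  have hν1 : ‖ν x‖ = 1 := by
    rw [hν x hx, norm_smul, norm_inv, norm_norm, inv_mul_cancel₀ (norm_ne_zero_iff.2 hGx)]
  obtain ⟨ι, hι⟩ := exists_linearIsometry_range_eq_orthogonal hV hν1
  have hcont : Continuous (gradient f) :=
    (InnerProductSpace.toDual ℝ V).symm.continuous.comp (h.contDiff.continuous_fderiv one_ne_zero)
  have hmeas : Measurable fun y => |⟪ν x, y - x⟫ * ⟪y - x, ‖gradient f y‖⁻¹ • gradient f y⟫| /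
      ‖x - y‖ ^ (d + 2) := by
    have := hcont.measurable
    fun_prop
  rw [setIntegral_congr_fun (g := fun y => |⟪ν x, y - x⟫ *
      ⟪y - x, ‖gradient f y‖⁻¹ • gradient f y⟫| / ‖x - y‖ ^ (d + 2))
      isClosed_frontier.measurableSet (fun y hy => by simp only [hν y hy]),
    integral_eq_lintegral_of_nonneg_ae (.of_forall fun y => by positivity)
      hmeas.aestronglyMeasurable,
    integral_eq_lintegral_of_nonneg_ae (.of_forall fun y => abs_nonneg _)
      (by fun_prop : Continuous fun w => |⟪a, w⟫|).aestronglyMeasurable,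
    setLIntegral_frontier_kernel hV ι hν1 hι h hx (hν x hx),
    setLIntegral_sphere_abs_inner hV ι hν1 hι ha, ENNReal.toReal_mul]
  simp

end Frontier

end KernelIntegral

/-- For a bounded open convex set `Ω ⊆ ℝⁿ` (n ≥ 2) with `C¹` boundary
and outward unit normal `ν`, for every boundary point `x ∈ ∂Ω` one has
`∫_{∂Ω} |⟨ν(x), y-x⟩⟨y-x, ν(y)⟩| / ‖x-y‖^{n+1} dσ(y) = c_n`,
where `c_n = (1/2) ∫_{S^{n-1}} |w₁| dσ(w)`. -/
theorem statement3 (n : ℕ) (hn : 2 ≤ n)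
    (Ω : Set (EuclideanSpace ℝ (Fin n)))
    (hΩopen : IsOpen Ω) (hΩbdd : Bornology.IsBounded Ω) (hΩconv : Convex ℝ Ω)
    (f : EuclideanSpace ℝ (Fin n) → ℝ) (hf : ContDiff ℝ 1 f)
    (hΩf : Ω = {x | f x < 0})
    (hfr : frontier Ω = {x | f x = 0})
    (hgrad : ∀ x ∈ frontier Ω, gradient f x ≠ 0)
    (ν : EuclideanSpace ℝ (Fin n) → EuclideanSpace ℝ (Fin n))
    (hν : ∀ x ∈ frontier Ω, ν x = ‖gradient f x‖⁻¹ • gradient f x)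
    (x : EuclideanSpace ℝ (Fin n)) (hx : x ∈ frontier Ω) :
    (∫ y in frontier Ω,
        |⟪ν x, y - x⟫ * ⟪y - x, ν y⟫| / ‖x - y‖ ^ (n + 1) ∂(μH[(n : ℝ) - 1]))
      = (1 : ℝ) / 2 *
          ∫ w in Metric.sphere (0 : EuclideanSpace ℝ (Fin n)) 1,
            |w ⟨0, by omega⟩| ∂(μH[(n : ℝ) - 1]) := by
  obtain ⟨d, rfl⟩ : ∃ d, n = d + 1 := ⟨n - 1, by omega⟩
  have h : IsConvexSublevel Ω f := ⟨hΩconv, hΩbdd, hf, hΩf, hfr, fun y hy h0 =>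
    hgrad y hy (by rw [gradient, h0, map_zero])⟩
  have key := h.setIntegral_frontier_kernel (finrank_euclideanSpace_fin) hν hx
    (a := EuclideanSpace.single 0 1) (by simp)
  have hd : ((d + 1 : ℕ) : ℝ) - 1 = d := by push_cast; ring
  rw [hd]
  simpa [EuclideanSpace.inner_single_left] using key
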